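/- arXiv:2306.06104 — 4 statements merged into one kernel-verified Lean document; each statement's English description precedes it below -/
import Mathlib

section
/- Let u = (u_1, …, u_p) and b = (b_1, …, b_y) be nonincreasing sequences of integers, and let u ∪ b denote the nonincreasing rearrangement of the concatenation of u and b (a nonincreasing sequence of length p + y). Then u ∪ b ≺′ (u, b). -/
/-- Index `h_j = min{ i : d_{i-j+1} < g_i }` from the definition of generalized
majorization, with the conventions `d_i = +∞` for `i < 1` (hence `j ≤ i`) and
`d_i = -∞` for `i > m` (hence the disjunct `m < i - j + 1`). -/
noncomputable def hIdx (m : ℕ) (d g : ℕ → ℤ) (j : ℕ) : ℕ :=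
  sInf {i : ℕ | j ≤ i ∧ (m < i - j + 1 ∨ d (i - j + 1) < g i)}

/-- Generalized majorization `g ≺′ (d, a)` for nonincreasing integer sequences
`d = (d_1, …, d_m)`, `a = (a_1, …, a_s)` and `g = (g_1, …, g_{m+s})`:
(i) `d_i ≥ g_{i+s}` for `1 ≤ i ≤ m`;
(ii) `Σ_{i=1}^{h_j} g_i − Σ_{i=1}^{h_j−j} d_i ≤ Σ_{i=1}^{j} a_i` for `1 ≤ j ≤ s`;
(iii) `Σ_{i=1}^{m+s} g_i = Σ_{i=1}^{m} d_i + Σ_{i=1}^{s} a_i`. -/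
def GenMaj (m s : ℕ) (d a g : ℕ → ℤ) : Prop :=
  (∀ i, 1 ≤ i → i ≤ m → g (i + s) ≤ d i) ∧
  (∀ j, 1 ≤ j → j ≤ s →
    (∑ i ∈ Finset.Icc 1 (hIdx m d g j), g i)
      - (∑ i ∈ Finset.Icc 1 (hIdx m d g j - j), d i) ≤ ∑ i ∈ Finset.Icc 1 j, a i) ∧
  (∑ i ∈ Finset.Icc 1 (m + s), g i)
    = (∑ i ∈ Finset.Icc 1 m, d i) + ∑ i ∈ Finset.Icc 1 s, a i

/-!
STATEMENT 3: Let u = (u_1, …, u_p) and b = (b_1, …, b_y) be nonincreasing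
sequences of integers, and let u ∪ b denote the nonincreasing rearrangement of
the concatenation of u and b (a nonincreasing sequence of length p + y).
Then u ∪ b ≺′ (u, b).

The sequence v below encodes u ∪ b: it is nonincreasing on 1..p+y and the
multiset of its values on 1..p+y is the union of the multisets of values of u
on 1..p and of b on 1..y.
-/

def cntGe (n : ℕ) (w : ℕ → ℤ) (t : ℤ) : ℕ := ((Finset.Icc 1 n).filter (fun i => t ≤ w i)).card

lemma cntGe_lower (n : ℕ) (w : ℕ → ℤ) (t : ℤ)
    (hw : ∀ i j, 1 ≤ i → i ≤ j → j ≤ n → w j ≤ w i) (k : ℕ) (hkn : k ≤ n)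
    (h : t ≤ w k) : k ≤ cntGe n w t := by
  have : Finset.Icc 1 k ⊆ (Finset.Icc 1 n).filter (fun i => t ≤ w i) := by
    intro i hi
    simp only [Finset.mem_Icc, Finset.mem_filter] at hi ⊢
    exact ⟨by omega, le_trans h (hw i k hi.1 hi.2 hkn)⟩
  have h2 := Finset.card_le_card this
  simpa [cntGe] using h2

lemma cntGe_upper (n : ℕ) (w : ℕ → ℤ) (t : ℤ)
    (hw : ∀ i j, 1 ≤ i → i ≤ j → j ≤ n → w j ≤ w i) (k : ℕ)
    (h : k + 1 ≤ n → w (k + 1) < t) : cntGe n w t ≤ k := by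
  have : (Finset.Icc 1 n).filter (fun i => t ≤ w i) ⊆ Finset.Icc 1 k := by
    intro i hi
    simp only [Finset.mem_Icc, Finset.mem_filter] at hi ⊢
    refine ⟨hi.1.1, ?_⟩
    by_contra hc
    have := hw (k+1) i (by omega) (by omega) hi.1.2
    have := h (by omega)
    omega
  have h2 := Finset.card_le_card this
  simpa [cntGe] using h2

lemma sum_pos_part (n k : ℕ) (w : ℕ → ℤ) (t : ℤ) (hk : k ≤ n)
    (h1 : ∀ i, 1 ≤ i → i ≤ k → t ≤ w i) (h2 : ∀ i, k < i → i ≤ n → w i ≤ t) :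
    ∑ i ∈ Finset.Icc 1 n, max (w i - t) 0 = ∑ i ∈ Finset.Icc 1 k, w i - k * t := by
  have hs : Finset.Icc 1 k ⊆ Finset.Icc 1 n := Finset.Icc_subset_Icc le_rfl hk
  rw [← Finset.sum_subset hs]
  · rw [Finset.sum_congr rfl (g := fun i => w i - t)]
    · simp
    · intro i hi
      simp only [Finset.mem_Icc] at hi
      have := h1 i hi.1 hi.2
      omega
  · intro i hi hi'
    simp only [Finset.mem_Icc] at hi hi'
    have := h2 i (by omega) hi.2
    omega

theorem stmt3 (p y : ℕ) (u b v : ℕ → ℤ)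
    (hu : ∀ i j, 1 ≤ i → i ≤ j → j ≤ p → u j ≤ u i)
    (hb : ∀ i j, 1 ≤ i → i ≤ j → j ≤ y → b j ≤ b i)
    (hv : ∀ i j, 1 ≤ i → i ≤ j → j ≤ p + y → v j ≤ v i)
    (hperm : (Finset.Icc 1 (p + y)).val.map v
      = (Finset.Icc 1 p).val.map u + (Finset.Icc 1 y).val.map b) :
    GenMaj p y u b v := by
  have hF : ∀ F : ℤ → ℤ, ∑ i ∈ Finset.Icc 1 (p + y), F (v i)
      = ∑ i ∈ Finset.Icc 1 p, F (u i) + ∑ i ∈ Finset.Icc 1 y, F (b i) := by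
    intro F
    have := congrArg (fun m => (m.map F).sum) hperm
    simp only [Multiset.map_add, Multiset.sum_add, Multiset.map_map] at this
    exact this
  have hC : ∀ t, cntGe (p + y) v t = cntGe p u t + cntGe y b t := by
    intro t
    have := hF (fun x => if t ≤ x then 1 else 0)
    simp only [Finset.sum_boole] at this
    exact_mod_cast this
  refine ⟨?_, ?_, hF (fun x => x)⟩
  · intro i h1 h2
    by_contra hc
    have e := hC (v (i + y))
    have e1 := cntGe_lower (p + y) v (v (i + y)) hv (i + y) (by omega) le_rfl
    have e2 := cntGe_upper p u (v (i + y)) hu (i - 1) (by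
      intro _; rw [show i - 1 + 1 = i by omega]; omega)
    have e3 := cntGe_upper y b (v (i + y)) hb y (by omega)
    omega
  · intro j hj1 hjy
    have hmem : p + j ∈ {i : ℕ | j ≤ i ∧ (p < i - j + 1 ∨ u (i - j + 1) < v i)} :=
      ⟨by omega, Or.inl (by omega)⟩
    have hle : hIdx p u v j ≤ p + j := Nat.sInf_le hmem
    have hin := Nat.sInf_mem ⟨_, hmem⟩
    have hmin : ∀ i, j ≤ i → i < hIdx p u v j → v i ≤ u (i - j + 1) := by
      intro i hi hlt
      have := Nat.notMem_of_lt_sInf hlt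
      simp only [Set.mem_ofPred_eq, not_and, not_or, not_lt] at this
      exact (this hi).2
    change j ≤ hIdx p u v j ∧ (p < hIdx p u v j - j + 1 ∨
      u (hIdx p u v j - j + 1) < v (hIdx p u v j)) at hin
    generalize hIdx p u v j = h at *
    obtain ⟨hjh, hin⟩ := hin
    obtain ⟨k, rfl⟩ : ∃ k, h = k + j := ⟨h - j, by omega⟩
    simp only [Nat.add_sub_cancel] at hin ⊢
    obtain ⟨t, ht⟩ : ∃ t, t = v (k + j) := ⟨_, rfl⟩
    have hu1 : ∀ i, 1 ≤ i → i ≤ k → t ≤ u i := by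
      intro i hi1 hik
      have a1 := hmin (k + j - 1) (by omega) (by omega)
      rw [show k + j - 1 - j + 1 = k by omega] at a1
      have a2 := hv (k + j - 1) (k + j) (by omega) (by omega) (by omega)
      have a3 := hu i k hi1 hik (by omega)
      omega
    have hu2 : ∀ i, k < i → i ≤ p → u i < t := by
      intro i hi1 hik
      have a3 := hu (k + 1) i (by omega) (by omega) (by omega)
      omega
    have hb1 : ∀ i, 1 ≤ i → i ≤ j → t ≤ b i := by
      intro i hi1 hij
      by_contra hc
      have a := hb i j hi1 hij hjy
      have e := hC t
      have e1 := cntGe_lower (p + y) v t hv (k + j) (by omega) (by omega)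
      have e2 := cntGe_upper p u t hu k (fun hh => hu2 _ (by omega) hh)
      have e3 := cntGe_upper y b t hb (j - 1) (by
        intro _; rw [show j - 1 + 1 = j by omega]; omega)
      omega
    have hb2 : ∀ i, j < i → i ≤ y → b i ≤ t := by
      intro i hi1 hiy
      by_contra hc
      have a := hb (j + 1) i (by omega) (by omega) hiy
      have e := hC (t + 1)
      have e1 := cntGe_lower y b (t + 1) hb (j + 1) (by omega) (by omega)
      have e2 := cntGe_upper (p + y) v (t + 1) hv (k + j - 1) (by
        intro _; rw [show k + j - 1 + 1 = k + j by omega]; omega)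
      obtain ⟨C, hCC⟩ : ∃ C, C = cntGe (p + y) v (t + 1) := ⟨_, rfl⟩
      have e3 : t + 1 ≤ v C := by
        by_contra hc
        have := cntGe_upper (p + y) v (t + 1) hv (C - 1) (by
          intro _; rw [show C - 1 + 1 = C by omega]; omega)
        omega
      have e4 := hmin C (by omega) (by omega)
      have e5 := cntGe_lower p u (t + 1) hu (C - j + 1) (by omega) (by omega)
      omega
    have s0 := hF (fun x => max (x - t) 0)
    rw [sum_pos_part (p + y) (k + j) v t (by omega)
        (fun i h1 h2 => by have := hv i (k + j) h1 h2 (by omega); omega)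
        (fun i h1 h2 => by have := hv (k + j) i (by omega) (by omega) h2; omega),
      sum_pos_part p k u t (by omega) hu1 (fun i h1 h2 => (hu2 i h1 h2).le),
      sum_pos_part y j b t hjy hb1 hb2] at s0
    push_cast at s0
    linarith
end

section
/- Let c = (c_1, …, c_q) and a = (a_1, …, a_x) be nonincreasing sequences of integers with q > x ≥ 0, and let ℓ = min{ j ≥ 1 : Σ_{i=1}^{j} c_i > Σ_{i=1}^{j} a_i } (which satisfies 1 ≤ ℓ ≤ x+1). If there exists a nonincreasing sequence of integers d = (d_1, …, d_{q−x}) such that c ≺′ (d, a), then Σ_{i=1}^{x+1} c_i − c_ℓ ≥ Σ_{i=1}^{x} a_i, and Σ_{i=j+2}^{x+1} c_i ≥ Σ_{i=j+1}^{x} a_i for every j with ℓ ≤ j ≤ x − 1. -/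
/-- The set `{ j ≥ 1 : Σ_{i=1}^{j} c_i > Σ_{i=1}^{j} a_i }`, where the sums use
the convention `a_i = -∞` for `i > x` (disjunct `x < j`). -/
def ellSet (x : ℕ) (c a : ℕ → ℤ) : Set ℕ :=
  {j : ℕ | 1 ≤ j ∧ (x < j ∨ (∑ i ∈ Finset.Icc 1 j, a i) < ∑ i ∈ Finset.Icc 1 j, c i)}

/-!
STATEMENT 6: Let c = (c_1, …, c_q) and a = (a_1, …, a_x) be nonincreasing
sequences of integers with q > x ≥ 0, and let
ℓ = min{ j ≥ 1 : Σ_{i=1}^{j} c_i > Σ_{i=1}^{j} a_i } (which satisfies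
1 ≤ ℓ ≤ x+1).  If there exists a nonincreasing sequence of integers
d = (d_1, …, d_{q−x}) such that c ≺′ (d, a), then
Σ_{i=1}^{x+1} c_i − c_ℓ ≥ Σ_{i=1}^{x} a_i, and
Σ_{i=j+2}^{x+1} c_i ≥ Σ_{i=j+1}^{x} a_i for every j with ℓ ≤ j ≤ x − 1.
-/

theorem aux_split (f : ℕ → ℤ) (k n : ℕ) (h : k ≤ n) :
    ∑ i ∈ Finset.Icc (k + 1) n, f i
      = ∑ i ∈ Finset.Icc 1 n, f i - ∑ i ∈ Finset.Icc 1 k, f i := by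
  induction n, h using Nat.le_induction with
  | base => simp
  | succ n hn ih =>
    rw [Finset.sum_Icc_succ_top (by omega), Finset.sum_Icc_succ_top (by omega), ih]
    ring

theorem aux_d (m x : ℕ) (c d : ℕ → ℤ) (h : ∀ i, 1 ≤ i → i ≤ m → c (i + x) ≤ d i)
    (k n : ℕ) (hk : k ≤ n) : n ≤ m →
    ∑ i ∈ Finset.Icc 1 (n + x), c i - ∑ i ∈ Finset.Icc 1 (k + x), c i
      ≤ ∑ i ∈ Finset.Icc 1 n, d i - ∑ i ∈ Finset.Icc 1 k, d i := by
  induction n, hk using Nat.le_induction with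
  | base => simp
  | succ n hn ih =>
    intro hm
    have h1 := ih (by omega)
    have h2 := h (n + 1) (by omega) hm
    rw [show n + 1 + x = (n + x) + 1 by omega] at h2 ⊢
    rw [Finset.sum_Icc_succ_top (by omega), Finset.sum_Icc_succ_top (b := n) (by omega)]
    linarith

theorem aux_c (q : ℕ) (c : ℕ → ℤ) (hc : ∀ i j, 1 ≤ i → i ≤ j → j ≤ q → c j ≤ c i)
    (u v : ℕ) (huv : u ≤ v) (t : ℕ) : v + t ≤ q →
    ∑ i ∈ Finset.Icc 1 (v + t), c i - ∑ i ∈ Finset.Icc 1 v, c i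
      ≤ ∑ i ∈ Finset.Icc 1 (u + t), c i - ∑ i ∈ Finset.Icc 1 u, c i := by
  induction t with
  | zero => simp
  | succ t ih =>
    intro hq
    have h1 := ih (by omega)
    have h2 := hc (u + t + 1) (v + t + 1) (by omega) (by omega) (by omega)
    rw [← add_assoc, ← add_assoc, Finset.sum_Icc_succ_top (by omega),
      Finset.sum_Icc_succ_top (b := u + t) (by omega)]
    linarith

theorem stmt6 (q x : ℕ) (c a : ℕ → ℤ) (hxq : x < q)
    (hc : ∀ i j, 1 ≤ i → i ≤ j → j ≤ q → c j ≤ c i)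
    (ha : ∀ i j, 1 ≤ i → i ≤ j → j ≤ x → a j ≤ a i)
    (hex : ∃ d : ℕ → ℤ,
      (∀ i j, 1 ≤ i → i ≤ j → j ≤ q - x → d j ≤ d i) ∧ GenMaj (q - x) x d a c) :
    (∑ i ∈ Finset.Icc 1 x, a i)
      ≤ (∑ i ∈ Finset.Icc 1 (x + 1), c i) - c (sInf (ellSet x c a)) ∧
    ∀ j, sInf (ellSet x c a) ≤ j → j ≤ x - 1 →
      (∑ i ∈ Finset.Icc (j + 1) x, a i) ≤ ∑ i ∈ Finset.Icc (j + 2) (x + 1), c i := by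
  obtain ⟨d, hd, h1, h2, h3⟩ := hex
  have hmq : q - x + x = q := by omega
  rw [hmq] at h3
  have hne : (ellSet x c a).Nonempty := ⟨x + 1, by simp [ellSet]⟩
  have hmem := Nat.sInf_mem hne
  have hle : sInf (ellSet x c a) ≤ x + 1 := Nat.sInf_le (by simp [ellSet])
  set l := sInf (ellSet x c a) with hl
  obtain ⟨hl1, hl2⟩ := hmem
  have key : c l ≤ d 1 := by
    rcases Nat.lt_or_ge x l with hx | hx
    · have := h1 1 le_rfl (by omega)
      rwa [show l = 1 + x by omega]
    · by_contra hlt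
      push Not at hlt
      have hh : hIdx (q - x) d c l = l := by
        apply le_antisymm
        · apply Nat.sInf_le
          refine ⟨le_rfl, Or.inr ?_⟩
          simpa using hlt
        · apply le_csInf
          · exact ⟨l, le_rfl, Or.inr (by simpa using hlt)⟩
          · intro b hb
            exact hb.1
      have h := h2 l hl1 hx
      rw [hh] at h
      simp at h
      rcases hl2 with h' | h'
      · omega
      · linarith
  refine ⟨?_, ?_⟩
  · have h := aux_d (q - x) x c d h1 1 (q - x) (by omega) le_rfl
    rw [hmq, add_comm 1 x] at h
    simp only [Finset.Icc_self, Finset.sum_singleton] at h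
    linarith
  · intro j hj hjx
    have hS : ({i : ℕ | j ≤ i ∧ (q - x < i - j + 1 ∨ d (i - j + 1) < c i)}).Nonempty :=
      ⟨q - x + j, by omega, Or.inl (by omega)⟩
    have hm := Nat.sInf_mem hS
    have hu : hIdx (q - x) d c j ≤ q - x + j := Nat.sInf_le ⟨by omega, Or.inl (by omega)⟩
    change j ≤ hIdx (q - x) d c j ∧ (q - x < hIdx (q - x) d c j - j + 1 ∨
      d (hIdx (q - x) d c j - j + 1) < c (hIdx (q - x) d c j)) at hm
    have h := h2 j (by omega) (by omega)
    set k := hIdx (q - x) d c j with hk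
    obtain ⟨hm1, hm2⟩ := hm
    have hkj : j + 1 ≤ k := by
      by_contra hcon
      have he : k = j := by omega
      rw [he] at hm2
      simp at hm2
      rcases hm2 with h' | h'
      · omega
      · have := hc l j hl1 hj (by omega)
        linarith
    rw [aux_split a j x (by omega), aux_split c (j + 1) (x + 1) (by omega)]
    have hA := aux_d (q - x) x c d h1 (k - j) (q - x) (by omega) le_rfl
    have hC := aux_c q c hc (j + 1) k hkj (x - j) (by omega)
    rw [hmq] at hA
    rw [show k - j + x = k + (x - j) by omega] at hA
    rw [show j + 1 + (x - j) = x + 1 by omega] at hC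
    linarith
end

section
/- Let c = (c_1, …, c_q) and a = (a_1, …, a_x) be nonincreasing sequences of integers with q > x ≥ 0, and let ℓ = min{ j ≥ 1 : Σ_{i=1}^{j} c_i > Σ_{i=1}^{j} a_i }. Suppose Σ_{i=1}^{x+1} c_i − c_ℓ ≥ Σ_{i=1}^{x} a_i and Σ_{i=j+2}^{x+1} c_i ≥ Σ_{i=j+1}^{x} a_i for all ℓ ≤ j ≤ x − 1. Define d_1 = Σ_{i=1}^{x+1} c_i − Σ_{i=1}^{x} a_i and d_i = c_{i+x} for 2 ≤ i ≤ q − x. Then d_1 ≥ d_2 ≥ … ≥ d_{q−x}, and c ≺′ (d, a) where d = (d_1, …, d_{q−x}). -/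
/-!
STATEMENT 7: Let c = (c_1, …, c_q) and a = (a_1, …, a_x) be nonincreasing
sequences of integers with q > x ≥ 0, and let
ℓ = min{ j ≥ 1 : Σ_{i=1}^{j} c_i > Σ_{i=1}^{j} a_i }.  Suppose
Σ_{i=1}^{x+1} c_i − c_ℓ ≥ Σ_{i=1}^{x} a_i and
Σ_{i=j+2}^{x+1} c_i ≥ Σ_{i=j+1}^{x} a_i for all ℓ ≤ j ≤ x − 1.  Define
d_1 = Σ_{i=1}^{x+1} c_i − Σ_{i=1}^{x} a_i and d_i = c_{i+x} for 2 ≤ i ≤ q − x.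
Then d_1 ≥ d_2 ≥ … ≥ d_{q−x}, and c ≺′ (d, a) where d = (d_1, …, d_{q−x}).
-/

theorem pre_sub (f : ℕ → ℤ) (j x : ℕ) (h : j ≤ x) :
    ∑ i ∈ Finset.Icc (j + 1) x, f i
      = ∑ i ∈ Finset.Icc 1 x, f i - ∑ i ∈ Finset.Icc 1 j, f i := by
  induction x, h using Nat.le_induction with
  | base => simp
  | succ n hn ih =>
    rw [Finset.sum_Icc_succ_top (by omega), Finset.sum_Icc_succ_top (by omega), ih]
    ring

theorem stmt7 (q x : ℕ) (c a : ℕ → ℤ) (hxq : x < q)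
    (hc : ∀ i j, 1 ≤ i → i ≤ j → j ≤ q → c j ≤ c i)
    (ha : ∀ i j, 1 ≤ i → i ≤ j → j ≤ x → a j ≤ a i)
    (h1 : (∑ i ∈ Finset.Icc 1 x, a i)
      ≤ (∑ i ∈ Finset.Icc 1 (x + 1), c i) - c (sInf (ellSet x c a)))
    (h2 : ∀ j, sInf (ellSet x c a) ≤ j → j ≤ x - 1 →
      (∑ i ∈ Finset.Icc (j + 1) x, a i) ≤ ∑ i ∈ Finset.Icc (j + 2) (x + 1), c i)
    (d : ℕ → ℤ)
    (hd1 : d 1 = (∑ i ∈ Finset.Icc 1 (x + 1), c i) - ∑ i ∈ Finset.Icc 1 x, a i)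
    (hdi : ∀ i, 2 ≤ i → i ≤ q - x → d i = c (i + x)) :
    (∀ i j, 1 ≤ i → i ≤ j → j ≤ q - x → d j ≤ d i) ∧ GenMaj (q - x) x d a c := by
  have hS : ∀ (f : ℕ → ℤ) (n : ℕ), ∑ i ∈ Finset.Icc 1 (n + 1), f i
      = ∑ i ∈ Finset.Icc 1 n, f i + f (n + 1) := fun f n =>
    Finset.sum_Icc_succ_top (by omega) f
  have hmem : sInf (ellSet x c a) ∈ ellSet x c a :=
    Nat.sInf_mem ⟨x + 1, by omega, Or.inl (by omega)⟩
  have hle : sInf (ellSet x c a) ≤ x + 1 := Nat.sInf_le ⟨by omega, Or.inl (by omega)⟩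
  have hmin : ∀ j, 1 ≤ j → j ≤ x → j < sInf (ellSet x c a) →
      ∑ i ∈ Finset.Icc 1 j, c i ≤ ∑ i ∈ Finset.Icc 1 j, a i := by
    intro j hj hjx hlt
    by_contra hcon
    exact Nat.notMem_of_lt_sInf hlt ⟨hj, Or.inr (by omega)⟩
  have hl1 : 1 ≤ sInf (ellSet x c a) := hmem.1
  generalize sInf (ellSet x c a) = l at *
  have hdl : c l ≤ d 1 := by omega
  have hdx : c (x + 1) ≤ d 1 := le_trans (hc l (x + 1) hl1 hle (by omega)) hdl
  have hD : ∀ n, 1 ≤ n → n ≤ q - x → ∑ i ∈ Finset.Icc 1 n, d i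
      = ∑ i ∈ Finset.Icc 1 (n + x), c i - ∑ i ∈ Finset.Icc 1 x, a i := by
    intro n hn
    induction n, hn using Nat.le_induction with
    | base => intro _; simp [hd1, Nat.add_comm]
    | succ n hn ih =>
      intro h
      have e : n + 1 + x = (n + x) + 1 := by omega
      rw [hS, ih (by omega), hdi (n + 1) (by omega) h, e, hS]
      ring
  have hi : ∀ i, 1 ≤ i → i ≤ q - x → c (i + x) ≤ d i := by
    intro i h h'
    rcases Nat.lt_or_ge 1 i with h3 | h3
    · rw [hdi i h3 h']
    · obtain rfl : i = 1 := by omega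
      rw [Nat.add_comm]; exact hdx
  refine ⟨?_, hi, ?_, ?_⟩
  · intro i j h h' h''
    rcases Nat.lt_or_ge 1 j with h3 | h3
    · rw [hdi j h3 h'']
      exact le_trans (hc _ _ (by omega) (by omega) (by omega)) (hi i h (by omega))
    · obtain rfl : i = j := by omega
      exact le_rfl
  · intro j hj hjx
    have hne : {i : ℕ | j ≤ i ∧ (q - x < i - j + 1 ∨ d (i - j + 1) < c i)}.Nonempty :=
      ⟨q - x + j, by omega, Or.inl (by omega)⟩
    have hm : hIdx (q - x) d c j ∈
      {i : ℕ | j ≤ i ∧ (q - x < i - j + 1 ∨ d (i - j + 1) < c i)} := Nat.sInf_mem hne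
    have hub : hIdx (q - x) d c j ≤ q - x + j :=
      Nat.sInf_le ⟨by omega, Or.inl (by omega)⟩
    have hlt : ∀ i, j ≤ i → i < hIdx (q - x) d c j → c i ≤ d (i - j + 1) := by
      intro i hji hi'
      by_contra hcon
      exact Nat.notMem_of_lt_sInf hi' ⟨hji, Or.inr (by omega)⟩
    generalize hIdx (q - x) d c j = h at *
    obtain ⟨hjh, hm⟩ := hm
    rcases Nat.lt_or_ge j h with h3 | h3
    · have hdj : c j ≤ d 1 := by simpa using hlt j le_rfl h3
      have key : ∀ k, j + 1 ≤ k → k ≤ h →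
          ∑ i ∈ Finset.Icc 1 (k - j + x), c i - ∑ i ∈ Finset.Icc 1 k, c i
          = ∑ i ∈ Finset.Icc 1 (x + 1), c i - ∑ i ∈ Finset.Icc 1 (j + 1), c i := by
        intro k hk
        induction k, hk using Nat.le_induction with
        | base =>
          intro _
          have e : j + 1 - j + x = x + 1 := by omega
          rw [e]
        | succ k hk ih =>
          intro hkh
          have e : k + 1 - j + x = (k - j + x) + 1 := by omega
          have t := hlt k (by omega) (by omega)
          rw [hdi (k - j + 1) (by omega) (by omega)] at t
          have e2 : k - j + 1 + x = (k - j + x) + 1 := by omega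
          rw [e2] at t
          have t1 := hc k (k + 1) (by omega) (by omega) (by omega)
          have t2 := hc (k + 1) (k - j + x + 1) (by omega) (by omega) (by omega)
          rw [e, hS, hS]
          have := ih (by omega)
          omega
      have k1 := key h h3 le_rfl
      rw [hD (h - j) (by omega) (by omega)]
      have goal' : ∑ i ∈ Finset.Icc 1 x, a i - ∑ i ∈ Finset.Icc 1 j, a i ≤
          ∑ i ∈ Finset.Icc 1 (x + 1), c i - ∑ i ∈ Finset.Icc 1 (j + 1), c i := by
        rcases Nat.lt_or_ge j l with h4 | h4
        · have := hmin j hj hjx h4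
          have t1 := hc j (j + 1) (by omega) (by omega) (by omega)
          have := hS c j
          omega
        · rcases Nat.lt_or_ge j x with h5 | h5
          · have := h2 j h4 (by omega)
            rw [pre_sub a j x (by omega), pre_sub c (j + 1) (x + 1) (by omega)] at this
            exact this
          · obtain rfl : j = x := by omega
            simp
      omega
    · obtain rfl : h = j := by omega
      simp only [Nat.sub_self, Nat.zero_add] at hm ⊢
      have h5 : d 1 < c h := by
        rcases hm with hm | hm
        · omega
        · exact hm
      have : h < l := by
        by_contra hcon
        have := hc l h hl1 (by omega) (by omega)
        omega
      simpa using hmin h hj hjx this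
  · rw [hD (q - x) (by omega) le_rfl]
    ring
end

section
/- Let F be a field, let α and β be nonzero polynomials in F[s] of degrees n and m respectively, and let k and ℓ be nonnegative integers. In the polynomial ring F[s, t] define the shifted homogenizations φ(s,t) = t^k · Σ_{i=0}^{n} α_i s^i t^{n−i} and ψ(s,t) = t^ℓ · Σ_{i=0}^{m} β_i s^i t^{m−i}, where α_i and β_i denote the coefficients of α and β. Then φ divides ψ in F[s, t] if and only if α divides β in F[s] and k ≤ ℓ. -/
/-!
STATEMENT 11: Let F be a field, let α and β be nonzero polynomials in F[s] of
degrees n and m respectively, and let k and ℓ be nonnegative integers.  In the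
polynomial ring F[s, t] define the shifted homogenizations
φ(s,t) = t^k · Σ_{i=0}^{n} α_i s^i t^{n−i} and
ψ(s,t) = t^ℓ · Σ_{i=0}^{m} β_i s^i t^{m−i}, where α_i and β_i denote the
coefficients of α and β.  Then φ divides ψ in F[s, t] if and only if α divides
β in F[s] and k ≤ ℓ.

F[s,t] is modelled as `MvPolynomial (Fin 2) F`, with s = X 0 and t = X 1.
-/

open Polynomial in
theorem hom_sum_aux (F : Type*) [Field F] (α : Polynomial F) (n : ℕ) (hn : α.natDegree = n) :
    (∑ i ∈ Finset.range (n + 1),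
          MvPolynomial.C (α.coeff i) * MvPolynomial.X 0 ^ i * MvPolynomial.X 1 ^ (n - i) :
        MvPolynomial (Fin 2) F) = α.homogenize n := by
  conv_rhs => rw [α.as_sum_range' (n + 1) (by omega), Polynomial.homogenize_finsetSum]
  refine Finset.sum_congr rfl fun i hi => ?_
  have hi' : i ≤ n := by simpa [Nat.lt_succ_iff] using hi
  rw [← Polynomial.C_mul_X_pow_eq_monomial, Polynomial.homogenize_C_mul,
    Polynomial.homogenize_X_pow hi', mul_assoc]

theorem eval_aux (F : Type*) [Field F] (α : Polynomial F) (hα : α ≠ 0) (n : ℕ)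
    (hn : α.natDegree = n) :
    ¬ (Polynomial.X ∣ MvPolynomial.aeval ![1, (Polynomial.X : Polynomial F)]
      (∑ i ∈ Finset.range (n + 1),
          MvPolynomial.C (α.coeff i) * MvPolynomial.X 0 ^ i * MvPolynomial.X 1 ^ (n - i) :
        MvPolynomial (Fin 2) F)) := by
  rw [Polynomial.X_dvd_iff, Polynomial.coeff_zero_eq_eval_zero]
  simp only [map_sum, map_mul, map_pow, MvPolynomial.aeval_X, MvPolynomial.aeval_C,
    Polynomial.eval_finset_sum, Polynomial.algebraMap_eq]
  rw [Finset.sum_range_succ, Finset.sum_eq_zero]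
  · subst hn
    simpa using hα
  · intro i hi
    have : n - i ≠ 0 := by have := Finset.mem_range.1 hi; omega
    simp [this]

theorem stmt11 (F : Type*) [Field F] (α β : Polynomial F) (hα : α ≠ 0) (hβ : β ≠ 0)
    (n m : ℕ) (hn : α.natDegree = n) (hm : β.natDegree = m) (k l : ℕ) :
    ((MvPolynomial.X 1 ^ k *
        ∑ i ∈ Finset.range (n + 1),
          MvPolynomial.C (α.coeff i) * MvPolynomial.X 0 ^ i * MvPolynomial.X 1 ^ (n - i) :
        MvPolynomial (Fin 2) F) ∣
      (MvPolynomial.X 1 ^ l *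
        ∑ i ∈ Finset.range (m + 1),
          MvPolynomial.C (β.coeff i) * MvPolynomial.X 0 ^ i * MvPolynomial.X 1 ^ (m - i))) ↔
      (α ∣ β ∧ k ≤ l) := by
  constructor
  · intro h
    constructor
    · rw [hom_sum_aux F α n hn, hom_sum_aux F β m hm] at h
      have := map_dvd (MvPolynomial.aeval ![(Polynomial.X : Polynomial F), 1]) h
      simpa [Polynomial.aeval_homogenize_X_one, hn.le, hm.le] using this
    · by_contra! hlt
      have h2 := map_dvd (MvPolynomial.aeval ![1, (Polynomial.X : Polynomial F)]) h
      refine eval_aux F β hβ m hm ?_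
      rw [map_mul, map_mul, map_pow, map_pow, MvPolynomial.aeval_X] at h2
      have h3 := (pow_dvd_pow (Polynomial.X : Polynomial F) hlt).trans
        (dvd_of_mul_right_dvd h2)
      rw [Nat.succ_eq_add_one, pow_succ] at h3
      exact (mul_dvd_mul_iff_left (pow_ne_zero l Polynomial.X_ne_zero)).1 h3
  · rintro ⟨h, hkl⟩
    rw [hom_sum_aux F α n hn, hom_sum_aux F β m hm]
    subst hn hm
    exact mul_dvd_mul (pow_dvd_pow _ hkl) (Polynomial.homogenize_dvd h)
end
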